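/- (Well-definedness of the Borel–Moore boundary operator) Let R be a commutative ring, X a topological space, k ≥ 1, and let c be a Borel–Moore k-chain on X with coefficients in R. Then for every singular (k−1)-simplex τ of X, the set {(σ,p) | σ is a singular k-simplex of X, 0 ≤ p ≤ k, c(σ) ≠ 0 and σ ∘ ι_{k;p} = τ} is finite, and the function ∂c sending each singular (k−1)-simplex τ to ∑_{(σ,p)} (−1)^p c(σ), summed over this finite set, is a Borel–Moore (k−1)-chain on X with coefficients in R. -/

import Mathlib

open Set

attribute [local instance] Classical.propDecidable

noncomputable section

/-- The standard `k`-simplex, as a topological space. -/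
abbrev Δ (k : ℕ) : Type := ↥(stdSimplex ℝ (Fin (k+1)))

/-- A singular `k`-simplex in `X`: a continuous map from the standard `k`-simplex. -/
abbrev SSimplex (X : Type*) [TopologicalSpace X] (k : ℕ) : Type _ := C(Δ k, X)

/-- A Borel–Moore (locally finite) `k`-chain on `X` with coefficients in `R`. -/
def IsBMChain {X : Type*} [TopologicalSpace X] {R : Type*} [CommRing R] (k : ℕ)
    (c : SSimplex X k → R) : Prop :=
  ∀ x : X, ∃ U : Set X, IsOpen U ∧ x ∈ U ∧
    {σ : SSimplex X k | c σ ≠ 0 ∧ (Set.range ⇑σ ∩ U).Nonempty}.Finite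

/-- The affine map between standard simplices extending `e i ↦ e (m i)` on vertices. -/
def affMap {a b : ℕ} (m : Fin a → Fin b) :
    C(↥(stdSimplex ℝ (Fin a)), ↥(stdSimplex ℝ (Fin b))) where
  toFun t :=
    ⟨fun j => ∑ i, if m i = j then t.1 i else 0, by
      constructor
      · intro j
        refine Finset.sum_nonneg fun i _ => ?_
        by_cases h : m i = j
        · simpa [h] using t.2.1 i
        · simp [h]
      · rw [Finset.sum_comm]
        have h1 : ∀ i : Fin a, (∑ j, if m i = j then t.1 i else 0) = t.1 i := by
          intro i
          simp [Finset.sum_ite_eq]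
        calc (∑ i, ∑ j, if m i = j then t.1 i else 0) = ∑ i, t.1 i :=
              Finset.sum_congr rfl fun i _ => h1 i
          _ = 1 := t.2.2⟩
  continuous_toFun := by
    apply Continuous.subtype_mk
    apply continuous_pi
    intro j
    apply continuous_finset_sum
    intro i _
    by_cases h : m i = j
    · simp only [if_pos h]
      exact (continuous_apply i).comp continuous_subtype_val
    · simp only [h, if_false]
      exact continuous_const

/-- The `p`-th face inclusion `ι_{k+1;p} : Δ^k → Δ^{k+1}`, sending the vertices
`e_0, …, e_k` in order to the vertices `e_0, …, e_{p-1}, e_{p+1}, …, e_{k+1}`. -/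
def face (k : ℕ) (p : Fin (k+2)) : C(Δ k, Δ (k+1)) := affMap (Fin.succAbove p)

/-- The Borel–Moore boundary operator: `(∂c)(τ) = ∑_{(σ,p) : σ∘ι_{k+1;p} = τ} (-1)^p c(σ)`. -/
def bmBoundary {X : Type*} [TopologicalSpace X] {R : Type*} [CommRing R] (k : ℕ)
    (c : SSimplex X (k+1) → R) : SSimplex X k → R :=
  fun τ => ∑ᶠ σ : SSimplex X (k+1),
    ∑ p : Fin (k+2), if σ.comp (face k p) = τ then (-1 : R)^(p : ℕ) * c σ else 0

/-- If a face of `σ` meets `U`, then so does `σ`. -/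
theorem range_inter_nonempty_of_comp {X : Type*} [TopologicalSpace X] {k l : ℕ}
    {σ : SSimplex X l} {f : C(Δ k, Δ l)} {U : Set X}
    (h : (Set.range ⇑(σ.comp f) ∩ U).Nonempty) : (Set.range ⇑σ ∩ U).Nonempty :=
  h.mono (inter_subset_inter_left U (Set.range_comp_subset_range f σ))

/-- A simplex in the support of the boundary is a face of a simplex in the support of the chain. -/
theorem exists_face_of_bmBoundary_ne_zero {X : Type*} [TopologicalSpace X] {R : Type*}
    [CommRing R] {k : ℕ} {c : SSimplex X (k+1) → R} {τ : SSimplex X k}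
    (h : bmBoundary k c τ ≠ 0) :
    ∃ σ : SSimplex X (k+1), ∃ p : Fin (k+2), c σ ≠ 0 ∧ σ.comp (face k p) = τ := by
  obtain ⟨σ, hσ⟩ := not_forall.mp (mt finsum_eq_zero_of_forall_eq_zero h)
  obtain ⟨p, -, hp⟩ := Finset.exists_ne_zero_of_sum_ne_zero hσ
  obtain ⟨hτ, hc⟩ := ite_ne_right_iff.mp hp
  exact ⟨σ, p, right_ne_zero_of_mul hc, hτ⟩

theorem bmBoundary_wellDefined
    {X : Type*} [TopologicalSpace X] {R : Type*} [CommRing R] (k : ℕ)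
    (c : SSimplex X (k+1) → R) (hc : IsBMChain (k+1) c) :
    (∀ τ : SSimplex X k,
      {sp : SSimplex X (k+1) × Fin (k+2) |
        c sp.1 ≠ 0 ∧ sp.1.comp (face k sp.2) = τ}.Finite) ∧
    IsBMChain k (bmBoundary k c) := by
  refine ⟨fun τ => ?_, fun x => ?_⟩
  · obtain ⟨t⟩ : Nonempty (Δ k) := ⟨⟨Pi.single 0 1, single_mem_stdSimplex ℝ 0⟩⟩
    obtain ⟨U, -, hxU, hfin⟩ := hc (τ t)
    refine (hfin.prod (Set.finite_univ (α := Fin (k+2)))).subset ?_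
    rintro ⟨σ, p⟩ ⟨hσ, rfl⟩
    exact ⟨⟨hσ, range_inter_nonempty_of_comp ⟨_, mem_range_self t, hxU⟩⟩, mem_univ p⟩
  · obtain ⟨U, hU, hxU, hfin⟩ := hc x
    refine ⟨U, hU, hxU, ((hfin.prod (Set.finite_univ (α := Fin (k+2)))).image
      fun sp => sp.1.comp (face k sp.2)).subset ?_⟩
    rintro τ ⟨hτ, hτU⟩
    obtain ⟨σ, p, hσ, rfl⟩ := exists_face_of_bmBoundary_ne_zero hτ
    exact ⟨(σ, p), ⟨⟨hσ, range_inter_nonempty_of_comp hτU⟩, mem_univ p⟩, rfl⟩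

end
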